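/- arXiv:2403.15138 — 4 statements merged into one kernel-verified Lean document; each statement's English description precedes it below -/
import Mathlib

section
/- Let F be a field, let n, k ∈ ℕ with k < n − k, and let A ∈ M_n(F) be the block matrix with zero blocks of sizes k×k, k×(n−k), (n−k)×k and with an invertible non-derogatory matrix A₂₂ ∈ M_{n−k}(F) in the lower-right block. Then for every monic polynomial q(x) ∈ F[x] of degree n whose trace coincides with the trace of A (i.e. the coefficient of x^{n-1} in q equals minus the trace of A), there exists a square-zero matrix N ∈ M_n(F) such that the characteristic polynomial of A + N equals q(x). -/
open Polynomial Matrix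

/-- companion matrix -/
def compK {F : Type*} [Field F] (p : F[X]) (m : ℕ) : Matrix (Fin m) (Fin m) F :=
  Matrix.of fun i j => if (j : ℕ) + 1 = m then - p.coeff i else if (i : ℕ) = j + 1 then 1 else 0

theorem compK_sum {F : Type*} [Field F] (p : F[X]) (m : ℕ) (hm : p.coeff m = 1)
    {E : Type*} [AddCommGroup E] [Module F E] (e : ℕ → E)
    (h : ∑ i ∈ Finset.range (m + 1), p.coeff i • e i = 0) (j : Fin m) :
    ∑ i : Fin m, compK p m i j • e i = e (j + 1) := by
  unfold compK
  simp only [Matrix.of_apply]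
  by_cases hj : (j : ℕ) + 1 = m
  · simp only [hj, if_true]
    rw [Finset.sum_range_succ, hm, one_smul] at h
    rw [Fin.sum_univ_eq_sum_range (fun i => (-p.coeff i) • e i) m]
    simp only [neg_smul, Finset.sum_neg_distrib]
    exact (eq_neg_of_add_eq_zero_right h).symm
  · simp only [hj, if_false]
    have hlt : (j : ℕ) + 1 < m := by omega
    rw [Finset.sum_eq_single (⟨j + 1, hlt⟩ : Fin m)]
    · simp
    · intro b _ hb
      have : (b : ℕ) ≠ j + 1 := fun h => hb (Fin.ext h)
      simp [this]
    · simp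

theorem exists_cyclic {F : Type*} [Field F] (m : ℕ) (B : Matrix (Fin m) (Fin m) F)
    (h : minpoly F B = B.charpoly) :
    ∃ v : Fin m → F, ∀ g : F[X], (aeval B g) *ᵥ v = 0 → B.charpoly ∣ g := by
  obtain ⟨x, hx⟩ := Module.exists_ker_toSpanSingleton_eq_annihilator (R := F[X])
    (M := Module.AEval' (Matrix.toLin' B))
  refine ⟨(Module.AEval'.of (Matrix.toLin' B)).symm x, fun g hg => ?_⟩
  have h1 : g ∈ LinearMap.ker (LinearMap.toSpanSingleton F[X] _ x) := by
    rw [LinearMap.mem_ker, LinearMap.toSpanSingleton_apply]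
    apply (Module.AEval'.of (Matrix.toLin' B)).symm.injective
    rw [Module.AEval.of_symm_smul, map_zero, ← hg]
    have : aeval (Matrix.toLin' B) g = Matrix.toLin' (aeval B g) := by
      have := Polynomial.aeval_algHom_apply (Matrix.toLinAlgEquiv' : Matrix (Fin m) (Fin m) F ≃ₐ[F] _).toAlgHom B g
      exact this
    rw [this]
    rfl
  rw [hx, Module.AEval.annihilator_eq_ker_aeval, RingHom.mem_ker] at h1
  rw [← h, ← Matrix.minpoly_toLin']
  exact minpoly.dvd _ _ h1

theorem exists_companion_similar {F : Type*} [Field F] (m : ℕ) (B : Matrix (Fin m) (Fin m) F)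
    (h : minpoly F B = B.charpoly) :
    ∃ P : Matrix (Fin m) (Fin m) F, IsUnit P ∧ B * P = P * compK B.charpoly m := by
  obtain ⟨v, hv⟩ := exists_cyclic m B h
  have hdeg : B.charpoly.natDegree = m := by simp
  refine ⟨Matrix.of fun r i => ((B ^ (i : ℕ)) *ᵥ v) r, ?_, ?_⟩
  · rw [← Matrix.linearIndependent_cols_iff_isUnit, Fintype.linearIndependent_iff]
    intro g hg
    let G : F[X] := ∑ i : Fin m, C (g i) * X ^ (i : ℕ)
    have hG : G = 0 := by
      by_contra hne
      have hd := hv G (by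
        have : aeval B G = ∑ i : Fin m, g i • B ^ (i : ℕ) := by
          simp [G, Algebra.smul_def]
        rw [this, Matrix.sum_mulVec, ← hg]
        refine Finset.sum_congr rfl fun i _ => ?_
        rw [Matrix.smul_mulVec]
        rfl)
      have h2 := Polynomial.natDegree_le_of_dvd hd hne
      have h3 : G.degree < m := Polynomial.degree_sum_fin_lt g
      rw [Polynomial.degree_eq_natDegree hne] at h3
      have : G.natDegree < m := by exact_mod_cast h3
      omega
    intro i
    have : G.coeff i = g i := by
      simp only [G, finsetSum_coeff, coeff_C_mul, coeff_X_pow]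
      rw [Finset.sum_eq_single i]
      · simp
      · intro b _ hb
        have : ¬ (i : ℕ) = b := fun h => hb (Fin.ext h.symm)
        simp [this]
      · simp
    rw [← this, hG, coeff_zero]
  · have key := compK_sum B.charpoly m (by
      have := B.charpoly_monic.coeff_natDegree
      rwa [hdeg] at this) (fun i => (B ^ i) *ᵥ v) (by
      have h0 := B.aeval_self_charpoly
      rw [Polynomial.aeval_eq_sum_range, hdeg] at h0
      have := congrArg (fun M => M *ᵥ v) h0
      simpa [Matrix.sum_mulVec, Matrix.smul_mulVec] using this)
    ext r j
    have := congrFun (key j) r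
    rw [pow_succ', ← Matrix.mulVec_mulVec] at this
    simp only [Finset.sum_apply, Pi.smul_apply, smul_eq_mul] at this
    rw [Matrix.mul_apply, Matrix.mul_apply]
    simp only [Matrix.of_apply]
    refine Eq.trans ?_ (this.symm.trans ?_)
    · rfl
    · exact Finset.sum_congr rfl fun i _ => mul_comm _ _

theorem charpoly_of_family {F : Type*} [Field F] (q : F[X]) (hq : q.Monic)
    {ι : Type*} [Fintype ι] [DecidableEq ι] (hcard : Fintype.card ι = q.natDegree)
    (b : ι → AdjoinRoot q) (M : Matrix ι ι F)
    (h : ∀ j, AdjoinRoot.root q * b j = ∑ i, M i j • b i)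
    (h1 : (1 : AdjoinRoot q) ∈ Submodule.span F (Set.range b)) : M.charpoly = q := by
  have hclosed : ∀ y ∈ Submodule.span F (Set.range b),
      AdjoinRoot.root q * y ∈ Submodule.span F (Set.range b) := by
    intro y hy
    induction hy using Submodule.span_induction with
    | mem x hx =>
      obtain ⟨j, rfl⟩ := hx
      rw [h]
      exact Submodule.sum_mem _ fun i _ => Submodule.smul_mem _ _ (Submodule.subset_span ⟨i, rfl⟩)
    | zero => simp
    | add x y _ _ hx hy => rw [mul_add]; exact Submodule.add_mem _ hx hy
    | smul a x _ hx => rw [mul_smul_comm]; exact Submodule.smul_mem _ _ hx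
  have hpow : ∀ i : ℕ, AdjoinRoot.root q ^ i ∈ Submodule.span F (Set.range b) := by
    intro i
    induction i with
    | zero => simpa using h1
    | succ i ih => rw [pow_succ']; exact hclosed _ ih
  let pb := AdjoinRoot.powerBasis' hq
  have htop : ⊤ ≤ Submodule.span F (Set.range b) := by
    rw [← pb.basis.span_eq, Submodule.span_le]
    rintro _ ⟨i, rfl⟩
    rw [pb.basis_eq_pow]
    simpa [pb] using hpow i
  have hfin : Module.finrank F (AdjoinRoot q) = q.natDegree := by
    rw [pb.finrank]; simp [pb]
  let bb := basisOfTopLeSpanOfCardEqFinrank b htop (by rw [hfin, hcard])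
  have hbb : ∀ i, bb i = b i := fun i => by simp [bb]
  have hM : M = Algebra.leftMulMatrix bb (AdjoinRoot.root q) := by
    rw [Algebra.leftMulMatrix_apply]
    apply (Matrix.toLin bb bb).injective
    rw [Matrix.toLin_toMatrix]
    apply bb.ext
    intro j
    rw [Matrix.toLin_self]
    simp [hbb, h]
  have := Module.Finite.of_basis bb
  rw [hM, Algebra.leftMulMatrix_apply, LinearMap.charpoly_toMatrix, ← LinearMap.charpoly_toMatrix _ pb.basis,
    ← Algebra.leftMulMatrix_apply]
  have hg : pb.gen = AdjoinRoot.root q := by simp [pb]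
  rw [← hg, charpoly_leftMulMatrix, hg, AdjoinRoot.minpoly_root hq.ne_zero, hq.leadingCoeff]
  simp

theorem horner_solve {F : Type*} [Field F] (D : ℕ) : ∀ (s : ℕ → F) (_ : s D = 1) (g : F[X])
    (_ : g ∈ degreeLT F D), ∃ a : ℕ → F,
    ∑ i ∈ Finset.range (D + 1), C (s i) * ∑ l ∈ Finset.range i, X ^ (i - 1 - l) * C (a l) = g := by
  induction D with
  | zero =>
    intro s _ g hg
    refine ⟨0, ?_⟩
    simp only [mem_degreeLT] at hg
    have : g = 0 := by
      rw [← Polynomial.degree_eq_bot]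
      simpa using hg
    simp [this]
  | succ D ih =>
    intro s hs g hg
    let a0 := g.coeff D
    obtain ⟨a, ha⟩ := ih (fun i => s (i + 1)) hs
      (g - ∑ i ∈ Finset.range (D + 1), C (s (i + 1)) * (X ^ i * C a0)) (by
        rw [Polynomial.mem_degreeLT, Polynomial.degree_lt_iff_coeff_zero] at hg ⊢
        intro N hN
        simp only [coeff_sub, finsetSum_coeff, coeff_C_mul, coeff_mul_C, coeff_X_pow]
        rcases hN.eq_or_lt with rfl | hlt
        · rw [Finset.sum_eq_single D]
          · simp [hs, a0]
          · intro b _ hb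
            simp [Ne.symm hb]
          · simp
        · rw [hg N hlt, Finset.sum_eq_zero]
          · simp
          · intro i hi
            have : ¬ N = i := by
              have := Finset.mem_range.1 hi
              omega
            simp [this])
    refine ⟨fun l => Nat.casesOn l a0 a, ?_⟩
    rw [Finset.sum_range_succ']
    simp only [Finset.range_zero, Finset.sum_empty, mul_zero, add_zero]
    rw [eq_sub_iff_add_eq] at ha
    rw [← ha, ← Finset.sum_add_distrib]
    refine Finset.sum_congr rfl fun i _ => ?_
    rw [Finset.sum_range_succ', mul_add]
    congr 2
    refine Finset.sum_congr rfl fun l _ => ?_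
    congr 2
    omega

theorem span_W {F : Type*} [Field F] (k : ℕ) : ∀ g ∈ degreeLT F (2 * k), ∃ l : ℕ → F[X],
    (∀ i, l i ∈ degreeLT F 2) ∧
    g = ∑ i ∈ Finset.range k, X ^ (2 * i) * (X + 1) ^ (k - 1 - i) * l i := by
  induction k with
  | zero =>
    intro g hg
    refine ⟨0, fun i => Submodule.zero_mem _, ?_⟩
    have : g = 0 := by
      rw [← Polynomial.degree_eq_bot]
      simpa [mem_degreeLT] using hg
    simp [this]
  | succ k ih =>
    intro g hg
    let l0 : F[X] := C (g.coeff 0) + C (g.coeff 1 - k * g.coeff 0) * X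
    have hl0 : l0 ∈ degreeLT F 2 := by
      rw [mem_degreeLT, degree_lt_iff_coeff_zero]
      intro N hN
      simp only [l0, coeff_add, coeff_C_mul, coeff_X, coeff_C]
      rw [if_neg (by omega), if_neg (by omega)]
      simp
    have hdvd : (X : F[X]) ^ 2 ∣ g - (X + 1) ^ k * l0 := by
      rw [X_pow_dvd_iff]
      intro d hd
      have c0 : ((X + 1 : F[X]) ^ k).coeff 0 = 1 := by
        simp [coeff_X_add_one_pow]
      have c1 : ((X + 1 : F[X]) ^ k).coeff 1 = k := by
        simp [coeff_X_add_one_pow]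
      interval_cases d
      · simp [l0, mul_coeff_zero, c0]
      · rw [coeff_sub, mul_add, coeff_add, coeff_mul_C, ← mul_assoc, coeff_mul_X, coeff_mul_C, c0, c1]
        ring
    obtain ⟨g', hg'⟩ := hdvd
    have hdeg' : g' ∈ degreeLT F (2 * k) := by
      have h1 : X ^ 2 * g' ∈ degreeLT F (2 * (k + 1)) := by
        rw [← hg']
        apply Submodule.sub_mem _ hg
        have hX : ((X + 1 : F[X]) ^ k).natDegree ≤ k := by
          have := natDegree_X_pow_add_C (n := 1) (r := (1 : F))
          calc _ ≤ k * (X + 1 : F[X]).natDegree := natDegree_pow_le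
            _ = k := by simp at this; simp [this]
        rw [mem_degreeLT, degree_lt_iff_coeff_zero] at hl0 ⊢
        have hl : l0.natDegree ≤ 1 := natDegree_le_iff_coeff_eq_zero.2 fun N hN => hl0 N hN
        intro N hN
        apply coeff_eq_zero_of_natDegree_lt
        have := natDegree_mul_le (p := (X + 1 : F[X]) ^ k) (q := l0)
        omega
      rw [mem_degreeLT, degree_lt_iff_coeff_zero] at h1 ⊢
      intro N hN
      have := h1 (N + 2) (by omega)
      rwa [coeff_X_pow_mul] at this
    obtain ⟨l, hl, hsum⟩ := ih g' hdeg'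
    refine ⟨fun i => Nat.casesOn i l0 l, fun i => by cases i; exacts [hl0, hl _], ?_⟩
    rw [Finset.sum_range_succ']
    simp only [mul_zero, pow_zero, one_mul, Nat.add_sub_cancel, Nat.sub_zero]
    rw [sub_eq_iff_eq_add] at hg'
    rw [hg']
    refine congrArg (· + (X + 1) ^ k * l0) ?_
    conv_lhs => rw [hsum]
    rw [Finset.mul_sum]
    refine Finset.sum_congr rfl fun i _ => ?_
    rw [show k - (i + 1) = k - 1 - i by omega]
    ring

theorem span_W' {F : Type*} [Field F] (k t : ℕ) (g : F[X]) (hg : g ∈ degreeLT F (2 * k + 2 + t)) :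
    ∃ l : ℕ → F[X], (∀ i, l i ∈ degreeLT F (t + 2)) ∧
    g = ∑ i ∈ Finset.range (k + 1), X ^ (2 * i) * (X + 1) ^ (k - i) * l i := by
  have hmon : (X ^ (2 * (k + 1)) : F[X]).Monic := monic_X_pow _
  obtain ⟨l, hl, hs⟩ := span_W (k + 1) (g %ₘ X ^ (2 * (k + 1))) (by
    rw [mem_degreeLT]
    have := degree_modByMonic_lt g hmon
    rwa [degree_X_pow] at this)
  have hle : degreeLT F 2 ≤ degreeLT F (t + 2) := degreeLT_mono (by omega)
  refine ⟨fun i => l i + if i = k then X ^ 2 * (g /ₘ X ^ (2 * (k + 1))) else 0, fun i => ?_, ?_⟩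
  · refine Submodule.add_mem _ (hle (hl i)) ?_
    split_ifs
    · rw [mem_degreeLT, degree_lt_iff_coeff_zero] at hg ⊢
      intro N hN
      obtain ⟨N, rfl⟩ : ∃ N', N = N' + 2 := ⟨N - 2, by omega⟩
      rw [coeff_X_pow_mul]
      apply coeff_eq_zero_of_degree_lt
      have h1 : g.natDegree < 2 * k + 2 + t ∨ g = 0 := by
        by_cases h0 : g = 0
        · right; exact h0
        · left
          rw [natDegree_lt_iff_degree_lt h0, degree_lt_iff_coeff_zero]
          exact hg
      rcases h1 with h1 | h1
      · by_cases hz : g /ₘ X ^ (2 * (k + 1)) = 0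
        · rw [hz, degree_zero]; exact WithBot.bot_lt_coe _
        · have hlt : (g /ₘ X ^ (2 * (k + 1))).natDegree < N := by
            have hnd := natDegree_divByMonic g hmon
            rw [natDegree_X_pow] at hnd
            have : ¬ g.natDegree < 2 * (k + 1) := by
              intro hc
              apply hz
              rw [divByMonic_eq_zero_iff hmon, degree_X_pow]
              exact lt_of_le_of_lt degree_le_natDegree (by exact_mod_cast hc)
            omega
          rw [degree_eq_natDegree hz]
          exact_mod_cast hlt
      · simp [h1]
    · exact Submodule.zero_mem _
  · simp only [mul_add, Finset.sum_add_distrib, Nat.add_sub_cancel] at hs ⊢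
    rw [← hs]
    simp only [mul_ite, mul_zero]
    rw [Finset.sum_ite_eq' , if_pos (by simp)]
    conv_lhs => rw [← modByMonic_add_div g (X ^ (2 * (k + 1)))]
    refine congrArg (g %ₘ X ^ (2 * (k + 1)) + ·) ?_
    rw [Nat.sub_self, pow_zero, mul_one, ← mul_assoc, ← pow_add]
    rfl

theorem poly_model {F : Type*} [Field F] (k t : ℕ) (p q : F[X])
    (hp1 : p.coeff (k + t + 2) = 1)
    (hq : q.Monic) (hqd : q.natDegree = 2 * k + t + 3)
    (htr : q.coeff (2 * k + t + 2) = p.coeff (k + t + 1)) :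
    ∃ (w e : ℕ → F[X]) (x : ℕ → ℕ → F),
      (∀ i ≤ k, e i = X * w i) ∧
      (∀ i, X * e i = e (i + 1) + ∑ j ∈ Finset.range (k + 1), C (x j i) * w j) ∧
      (∑ i ∈ Finset.range (k + t + 2 + 1), C (p.coeff i) * e i = q) ∧
      ∃ l : ℕ → F[X], (∀ i, l i ∈ degreeLT F 2) ∧ 1 = ∑ i ∈ Finset.range (k + 1), w i * l i := by
  let w : ℕ → F[X] := fun i => X ^ (2 * i) * (X + 1) ^ (k - i)
  have hw : ∀ i, w i = X ^ (2 * i) * (X + 1) ^ (k - i) := fun _ => rfl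
  have hwdeg : ∀ i ≤ k, (w i).natDegree ≤ k + i := by
    intro i hi
    rw [hw]
    have h1 : (X + 1 : F[X]).natDegree = 1 := by
      have := natDegree_X_add_C (1 : F)
      simpa using this
    have h2 := natDegree_mul_le (p := (X : F[X]) ^ (2 * i)) (q := (X + 1) ^ (k - i))
    have h3 := natDegree_pow_le (p := (X + 1 : F[X])) (n := k - i)
    rw [natDegree_X_pow] at h2
    rw [h1] at h3
    omega
  let G : F[X] := ∑ i ∈ Finset.range k, C (p.coeff i) * (X * w i)
    + ∑ i ∈ Finset.range (t + 3), C (p.coeff (k + i)) * X ^ (2 * k + 1 + i) - q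
  have hG : G ∈ degreeLT F (2 * k + 2 + t) := by
    rw [mem_degreeLT, degree_lt_iff_coeff_zero]
    intro N hN
    have h1 : (∑ i ∈ Finset.range k, C (p.coeff i) * (X * w i)).coeff N = 0 := by
      rw [finsetSum_coeff]
      refine Finset.sum_eq_zero fun i hi => ?_
      have hi := Finset.mem_range.1 hi
      obtain ⟨N, rfl⟩ : ∃ N', N = N' + 1 := ⟨N - 1, by omega⟩
      rw [coeff_C_mul, coeff_X_mul, coeff_eq_zero_of_natDegree_lt (p := w i), mul_zero]
      have := hwdeg i hi.le
      omega
    obtain ⟨j, rfl⟩ : ∃ j, N = 2 * k + 1 + (t + 1 + j) := ⟨N - (2 * k + 2 + t), by omega⟩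
    have h2 : (∑ i ∈ Finset.range (t + 3), C (p.coeff (k + i)) * X ^ (2 * k + 1 + i)).coeff
        (2 * k + 1 + (t + 1 + j)) = if j < 2 then p.coeff (k + (t + 1 + j)) else 0 := by
      rw [finsetSum_coeff]
      simp only [coeff_C_mul, coeff_X_pow, add_right_inj, mul_ite, mul_one, mul_zero]
      rw [Finset.sum_ite_eq]
      congr 1
      simp only [Finset.mem_range, eq_iff_iff]
      omega
    simp only [G, coeff_sub, coeff_add]
    rw [h1, h2]
    rcases j with _ | _ | j
    · rw [show 2 * k + 1 + (t + 1 + 0) = 2 * k + t + 2 by ring, htr]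
      simp [add_assoc]
    · have := hq.coeff_natDegree
      rw [hqd] at this
      rw [show 2 * k + 1 + (t + 1 + (0 + 1)) = 2 * k + t + 3 by ring, this,
        show k + (t + 1 + (0 + 1)) = k + t + 2 by ring, hp1]
      simp
    · rw [if_neg (by omega), coeff_eq_zero_of_natDegree_lt (by omega)]
      simp
  obtain ⟨l, hl, hGl⟩ := span_W' k t G hG
  have hsolve := fun j => horner_solve (t + 2) (fun i => p.coeff (k + i)) hp1 (l j) (hl j)
  choose a ha using hsolve
  let η : ℕ → F[X] := fun r => ∑ j ∈ Finset.range (k + 1), C (a j r) * w j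
  have hη : ∑ i ∈ Finset.range (t + 3), C (p.coeff (k + i)) *
      ∑ r ∈ Finset.range i, X ^ (i - 1 - r) * η r = G := by
    rw [hGl]
    simp only [← ha, η, Finset.mul_sum]
    rw [Finset.sum_comm (s := Finset.range (k + 1))]
    refine Finset.sum_congr rfl fun i _ => ?_
    rw [Finset.sum_comm]
    refine Finset.sum_congr rfl fun j _ => Finset.sum_congr rfl fun r _ => ?_
    rw [hw]
    ring
  let e : ℕ → F[X] := fun i => if i < k then X * w i else
    X ^ (k + 1 + i) - ∑ r ∈ Finset.range (i - k), X ^ (i - k - 1 - r) * η r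
  have he1 : ∀ i ≤ k, e i = X * w i := by
    intro i hi
    rcases hi.lt_or_eq with h | rfl
    · simp [e, h]
    · simp [e, hw]
      ring
  have he2 : ∀ r, e (k + r) = X ^ (2 * k + 1 + r) - ∑ s ∈ Finset.range r, X ^ (r - 1 - s) * η s := by
    intro r
    simp only [e]
    rw [if_neg (by omega), Nat.add_sub_cancel_left]
    congr 2
    ring
  refine ⟨w, e, fun j i => if i < k then (if j = i + 1 then 1 else 0) else a j (i - k),
    he1, ?_, ?_, ?_⟩
  · intro i
    by_cases hi : i < k
    · simp only [hi, if_true]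
      rw [he1 i hi.le, he1 (i + 1) hi, Finset.sum_eq_single (i + 1)]
      · simp only [if_true, hw]
        rw [show k - i = k - (i + 1) + 1 by omega]
        simp only [map_one]
        ring
      · intro b _ hb
        simp [hb]
      · intro h
        exact absurd (Finset.mem_range.2 (by omega)) h
    · obtain ⟨r, rfl⟩ : ∃ r, i = k + r := ⟨i - k, by omega⟩
      simp only [hi, if_false, Nat.add_sub_cancel_left]
      change _ = _ + η r
      rw [he2, add_assoc k r 1, he2, Finset.sum_range_succ, mul_sub, Finset.mul_sum]
      have : ∑ s ∈ Finset.range r, X * (X ^ (r - 1 - s) * η s)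
          = ∑ s ∈ Finset.range r, X ^ (r + 1 - 1 - s) * η s := by
        refine Finset.sum_congr rfl fun s hs => ?_
        have := Finset.mem_range.1 hs
        rw [show r + 1 - 1 - s = r - 1 - s + 1 by omega]
        ring
      rw [this]
      simp
      ring
  · rw [show k + t + 2 + 1 = k + (t + 3) by ring, Finset.sum_range_add]
    have h1 : ∑ i ∈ Finset.range k, C (p.coeff i) * e i
        = ∑ i ∈ Finset.range k, C (p.coeff i) * (X * w i) :=
      Finset.sum_congr rfl fun i hi => by rw [he1 i (Finset.mem_range.1 hi).le]
    rw [h1]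
    simp only [he2, mul_sub, Finset.sum_sub_distrib]
    rw [hη]
    simp only [G]
    ring
  · obtain ⟨l, hl, h⟩ := span_W (k + 1) (1 : F[X]) (by
      rw [mem_degreeLT, degree_one]
      exact_mod_cast (by omega : 0 < 2 * (k + 1)))
    exact ⟨l, hl, by simpa [hw] using h⟩

theorem final_conj {F : Type*} [Field F] {k m : ℕ} (B K P : Matrix (Fin m) (Fin m) F)
    (hB : IsUnit B) (hP : IsUnit P) (hBP : B * P = P * K)
    (Y : Matrix (Fin k) (Fin m) F) (Z : Matrix (Fin m) (Fin k) F) :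
    ∃ N : Matrix (Fin k ⊕ Fin m) (Fin k ⊕ Fin m) F,
      N ^ 2 = 0 ∧ (Matrix.fromBlocks 0 0 0 B + N).charpoly = (Matrix.fromBlocks 0 Y Z K).charpoly := by
  obtain ⟨B, rfl⟩ := hB
  obtain ⟨P, rfl⟩ := hP
  -- conjugating matrix
  let D : Matrix (Fin m) (Fin k) F := (B⁻¹).1 * P.1 * Z
  let S : Matrix (Fin k ⊕ Fin m) (Fin k ⊕ Fin m) F := Matrix.fromBlocks 1 0 D P.1
  let T : Matrix (Fin k ⊕ Fin m) (Fin k ⊕ Fin m) F := Matrix.fromBlocks 1 0 (-((P⁻¹).1 * D)) (P⁻¹).1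
  have hST : S * T = 1 := by
    simp only [S, T, Matrix.fromBlocks_multiply]
    rw [← Matrix.fromBlocks_one]
    congr 1 <;> simp
  have hTS : T * S = 1 := mul_eq_one_comm.1 hST
  let N0 : Matrix (Fin k ⊕ Fin m) (Fin k ⊕ Fin m) F := Matrix.fromBlocks 0 Y 0 0
  have hN0 : N0 * N0 = 0 := by
    simp [N0, Matrix.fromBlocks_multiply]
  refine ⟨S * N0 * T, ?_, ?_⟩
  · calc (S * N0 * T) ^ 2 = S * N0 * (T * S) * N0 * T := by simp only [pow_two, Matrix.mul_assoc]
      _ = 0 := by rw [hTS, Matrix.mul_one, Matrix.mul_assoc S, hN0]; simp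
  · have hA : Matrix.fromBlocks 0 0 0 B.1 * S = S * Matrix.fromBlocks 0 0 Z K := by
      simp only [S, D, Matrix.fromBlocks_multiply]
      rw [Matrix.mul_assoc (B⁻¹).1, ← Matrix.mul_assoc B.1, Units.mul_inv, Matrix.one_mul, hBP]
      congr 1 <;> simp
    have hsum : Matrix.fromBlocks 0 0 0 B.1 + S * N0 * T
        = S * Matrix.fromBlocks 0 Y Z K * T := by
      have h1 : (Matrix.fromBlocks 0 Y Z K : Matrix (Fin k ⊕ Fin m) (Fin k ⊕ Fin m) F)
          = Matrix.fromBlocks 0 0 Z K + N0 := by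
        simp [N0, Matrix.fromBlocks_add]
      rw [h1, Matrix.mul_add, Matrix.add_mul, ← hA, Matrix.mul_assoc _ S T, hST, Matrix.mul_one]
    rw [hsum]
    rw [Matrix.mul_assoc, Matrix.charpoly_mul_comm, Matrix.mul_assoc, hTS, Matrix.mul_one]

theorem core_zero {F : Type*} [Field F] {m : ℕ} (hm : 0 < m) (B : Matrix (Fin m) (Fin m) F)
    (hND : minpoly F B = B.charpoly) (q : F[X]) (hq : q.Monic) (hqd : q.natDegree = m)
    (htr : q.coeff (m - 1) = B.charpoly.coeff (m - 1)) :
    ∃ N : Matrix (Fin m) (Fin m) F, N ^ 2 = 0 ∧ (B + N).charpoly = q := by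
  obtain ⟨P, ⟨P, rfl⟩, hP⟩ := exists_companion_similar m B hND
  set p := B.charpoly
  have hqm : q.coeff m = 1 := by
    have := hq.coeff_natDegree
    rwa [hqd] at this
  have hK : (compK q m).charpoly = q := by
    refine charpoly_of_family q hq (by simp [hqd]) (fun i : Fin m => AdjoinRoot.root q ^ (i : ℕ))
      _ ?_ ?_
    · intro j
      rw [compK_sum q m hqm (fun i => AdjoinRoot.root q ^ i), pow_succ']
      have h0 : aeval (AdjoinRoot.root q) q = 0 := by simp
      rwa [aeval_eq_sum_range, hqd] at h0
    · exact Submodule.subset_span ⟨⟨0, hm⟩, by simp⟩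
  have hN0 : (compK q m - compK p m) * (compK q m - compK p m) = 0 := by
    ext i j
    rw [Matrix.mul_apply]
    refine Finset.sum_eq_zero fun l _ => ?_
    simp only [compK, Matrix.sub_apply, Matrix.of_apply]
    by_cases hl : (l : ℕ) + 1 = m
    · by_cases hj : (j : ℕ) + 1 = m
      · have : (l : ℕ) = m - 1 := by omega
        simp [hj, this, htr]
      · simp [hj]
    · simp [hl]
  have hB : B = P.1 * compK p m * (P⁻¹).1 := by
    rw [← hP, Matrix.mul_assoc, Units.mul_inv, Matrix.mul_one]
  refine ⟨P.1 * (compK q m - compK p m) * (P⁻¹).1, ?_, ?_⟩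
  · calc (P.1 * (compK q m - compK p m) * (P⁻¹).1) ^ 2
        = P.1 * (compK q m - compK p m) * ((P⁻¹).1 * P.1) * (compK q m - compK p m) * (P⁻¹).1 := by
          simp only [pow_two, Matrix.mul_assoc]
      _ = 0 := by rw [Units.inv_mul, Matrix.mul_one, Matrix.mul_assoc P.1, hN0]; simp
  · have : B + P.1 * (compK q m - compK p m) * (P⁻¹).1 = P.1 * compK q m * (P⁻¹).1 := by
      conv_lhs => rw [hB]
      rw [Matrix.mul_sub, Matrix.sub_mul]
      abel
    rw [this, Matrix.mul_assoc, Matrix.charpoly_mul_comm, Matrix.mul_assoc, Units.inv_mul,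
      Matrix.mul_one, hK]

theorem core_pos {F : Type*} [Field F] (k t : ℕ)
    (p q : F[X]) (hp1 : p.coeff (k + t + 2) = 1)
    (hq : q.Monic) (hqd : q.natDegree = 2 * k + t + 3)
    (htr : q.coeff (2 * k + t + 2) = p.coeff (k + t + 1)) :
    ∃ (Y : Matrix (Fin (k + 1)) (Fin (k + t + 2)) F) (Z : Matrix (Fin (k + t + 2)) (Fin (k + 1)) F),
      (Matrix.fromBlocks 0 Y Z (compK p (k + t + 2))).charpoly = q := by
  obtain ⟨w, e, x, h1, h2, h3, l, hl, h4⟩ := poly_model k t p q hp1 hq hqd htr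
  let φ := AdjoinRoot.mk q
  have hφC : ∀ (c : F) (g : F[X]), φ (C c * g) = c • φ g := by
    intro c g
    rw [map_mul, Algebra.smul_def]
    rfl
  have hφX : ∀ g : F[X], φ (X * g) = AdjoinRoot.root q * φ g := by
    intro g
    rw [map_mul]
    rfl
  let b : Fin (k + 1) ⊕ Fin (k + t + 2) → AdjoinRoot q :=
    Sum.elim (fun i => φ (w i)) (fun i => φ (e i))
  refine ⟨Matrix.of fun j i => x j i, Matrix.of fun i j => if (i : ℕ) = j then 1 else 0,
    charpoly_of_family q hq ?_ b _ ?_ ?_⟩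
  · simp [hqd]; ring
  · rintro (j | j)
    · simp only [b, Fintype.sum_sum_type, Sum.elim_inl, Sum.elim_inr, Matrix.fromBlocks_apply₁₁,
        Matrix.fromBlocks_apply₂₁, Matrix.zero_apply, zero_smul, Finset.sum_const_zero, zero_add,
        Matrix.of_apply]
      rw [Finset.sum_eq_single (⟨j, by omega⟩ : Fin (k + t + 2))]
      · simp [h1 j (by omega), hφX]
      · intro i _ hi
        have : ¬ (i : ℕ) = j := fun h => hi (Fin.ext h)
        simp [this]
      · simp
    · simp only [b, Fintype.sum_sum_type, Sum.elim_inl, Sum.elim_inr, Matrix.fromBlocks_apply₁₂,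
        Matrix.fromBlocks_apply₂₂, Matrix.of_apply]
      rw [compK_sum p (k + t + 2) hp1 (fun i => φ (e i)), ← hφX, h2, map_add, add_comm, map_sum]
      · simp only [hφC]
        rw [Finset.sum_range (fun i => x i j • φ (w i))]
      · simp only [← hφC]
        rw [← map_sum, h3]
        exact AdjoinRoot.mk_self
  · have hone : (1 : AdjoinRoot q) = φ 1 := (map_one _).symm
    rw [hone, h4, map_sum]
    refine Submodule.sum_mem _ fun i hi => ?_
    have hi := Finset.mem_range.1 hi
    have hli : l i = C ((l i).coeff 0) + C ((l i).coeff 1) * X := by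
      have hd := hl i
      rw [mem_degreeLT] at hd
      have : (l i).degree ≤ 1 := by
        rw [degree_le_iff_coeff_zero]
        intro N hN
        rw [degree_lt_iff_coeff_zero] at hd
        apply hd
        have : 1 < N := by exact_mod_cast hN
        exact this
      rw [add_comm]
      exact eq_X_add_C_of_degree_le_one this
    have : w i * l i = C ((l i).coeff 0) * w i + C ((l i).coeff 1) * e i := by
      rw [h1 i (by omega)]
      conv_lhs => rw [hli]
      ring
    rw [this, map_add, hφC, hφC]
    refine Submodule.add_mem _ (Submodule.smul_mem _ _ (Submodule.subset_span ?_))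
      (Submodule.smul_mem _ _ (Submodule.subset_span ?_))
    · exact ⟨Sum.inl ⟨i, hi⟩, rfl⟩
    · exact ⟨Sum.inr ⟨i, by omega⟩, rfl⟩

theorem core {F : Type*} [Field F] (k m : ℕ) (hk : k < m) (B : Matrix (Fin m) (Fin m) F)
    (hInv : IsUnit B) (hND : minpoly F B = B.charpoly)
    (q : F[X]) (hq : q.Monic) (hqd : q.natDegree = m + k)
    (htr : q.coeff (m + k - 1) = - B.trace) :
    ∃ N : Matrix (Fin k ⊕ Fin m) (Fin k ⊕ Fin m) F,
      N ^ 2 = 0 ∧ (Matrix.fromBlocks 0 0 0 B + N).charpoly = q := by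
  have : Nonempty (Fin m) := ⟨⟨0, by omega⟩⟩
  rw [Matrix.trace_eq_neg_charpoly_coeff, neg_neg, Fintype.card_fin] at htr
  rcases k with _ | k
  · obtain ⟨N, hN, hc⟩ := core_zero hk B hND q hq (by simpa using hqd) (by simpa using htr)
    refine ⟨Matrix.fromBlocks 0 0 0 N, ?_, ?_⟩
    · rw [pow_two] at hN ⊢
      simp [Matrix.fromBlocks_multiply, hN]
    · rw [Matrix.fromBlocks_add]
      simp only [add_zero]
      rw [Matrix.charpoly_fromBlocks_zero₁₂, hc]
      simp
  · obtain ⟨t, rfl⟩ : ∃ t, m = k + t + 2 := ⟨m - k - 2, by omega⟩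
    obtain ⟨P, hP, hBP⟩ := exists_companion_similar _ B hND
    have hp1 : B.charpoly.coeff (k + t + 2) = 1 := by
      have := B.charpoly_monic.coeff_natDegree
      rwa [Matrix.charpoly_natDegree_eq_dim, Fintype.card_fin] at this
    obtain ⟨Y, Z, hYZ⟩ := core_pos k t B.charpoly q hp1 hq (by omega) (by
      rw [show k + t + 2 + (k + 1) - 1 = 2 * k + t + 2 by omega] at htr
      exact htr)
    rw [← hYZ]
    exact final_conj B _ P hInv hP hBP Y Z

theorem prescribed_charpoly_block
    (F : Type*) [Field F] (n k : ℕ) (hk : k < n - k)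
    (A₂₂ : Matrix (Fin (n - k)) (Fin (n - k)) F)
    (hInv : IsUnit A₂₂)
    (hNonDerog : minpoly F A₂₂ = A₂₂.charpoly)
    (A : Matrix (Fin k ⊕ Fin (n - k)) (Fin k ⊕ Fin (n - k)) F)
    (hA : A = Matrix.fromBlocks 0 0 0 A₂₂)
    (q : Polynomial F) (hq : q.Monic) (hqdeg : q.natDegree = n)
    (htr : q.coeff (n - 1) = - A.trace) :
    ∃ N : Matrix (Fin k ⊕ Fin (n - k)) (Fin k ⊕ Fin (n - k)) F,
      N ^ 2 = 0 ∧ (A + N).charpoly = q := by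
  subst hA
  refine core k (n - k) hk A₂₂ hInv hNonDerog q hq (by omega) ?_
  rw [show n - k + k - 1 = n - 1 by omega, htr]
  simp [Matrix.trace]
end

section
/- Let F be a field and k ≥ 1, let p(x) ∈ F[x] be a monic polynomial of degree k with p(0) ≠ 0, and let A ∈ M_{2k}(F) be the block-diagonal matrix with blocks 0_{k×k} and the companion matrix C(p(x)). Let N ∈ M_{2k}(F) be any square-zero matrix such that A + N is invertible. Then there exists an invertible matrix P ∈ M_{2k}(F) with P⁻¹AP = A, and a matrix X ∈ M_k(F), such that P⁻¹NP is the block matrix with blocks X, −X², Id_k, −X (i.e. upper-left X, upper-right −X², lower-left the k×k identity, lower-right −X). -/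
open Polynomial Matrix

/-- The companion matrix of a (monic) polynomial `p`, as a `k × k` matrix:
1's on the subdiagonal, last column `(-p.coeff 0, …, -p.coeff (k-1))ᵀ`, zeros elsewhere. -/
def companionMatrix {F : Type*} [Field F] (k : ℕ) (p : Polynomial F) :
    Matrix (Fin k) (Fin k) F :=
  Matrix.of fun i j =>
    if (j : ℕ) = k - 1 then -p.coeff i
    else if (i : ℕ) = (j : ℕ) + 1 then 1 else 0

theorem squareZero_form
    (F : Type*) [Field F] (k : ℕ) (hk : 1 ≤ k)
    (p : Polynomial F) (hp : p.Monic) (hpdeg : p.natDegree = k) (hp0 : p.coeff 0 ≠ 0)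
    (A : Matrix (Fin k ⊕ Fin k) (Fin k ⊕ Fin k) F)
    (hA : A = Matrix.fromBlocks 0 0 0 (companionMatrix k p))
    (N : Matrix (Fin k ⊕ Fin k) (Fin k ⊕ Fin k) F)
    (hN : N ^ 2 = 0) (hInv : IsUnit (A + N)) :
    ∃ P : (Matrix (Fin k ⊕ Fin k) (Fin k ⊕ Fin k) F)ˣ,
      ∃ X : Matrix (Fin k) (Fin k) F,
        (↑P⁻¹ : Matrix (Fin k ⊕ Fin k) (Fin k ⊕ Fin k) F) * A * (↑P : Matrix (Fin k ⊕ Fin k) (Fin k ⊕ Fin k) F) = A ∧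
        (↑P⁻¹ : Matrix (Fin k ⊕ Fin k) (Fin k ⊕ Fin k) F) * N * (↑P : Matrix (Fin k ⊕ Fin k) (Fin k ⊕ Fin k) F) =
          Matrix.fromBlocks X (-(X ^ 2)) 1 (-X) := by
  obtain ⟨a, b, S, d, rfl⟩ : ∃ a b S d, N = Matrix.fromBlocks a b S d :=
    ⟨_, _, _, _, (Matrix.fromBlocks_toBlocks N).symm⟩
  subst hA
  rw [pow_two, Matrix.fromBlocks_multiply, ← Matrix.fromBlocks_zero, Matrix.fromBlocks_inj] at hN
  obtain ⟨h11, h12, h21, h22⟩ := hN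
  have hS : IsUnit S := by
    rw [← Matrix.mulVec_injective_iff_isUnit]
    have hinj := Matrix.mulVec_injective_iff_isUnit.mpr hInv
    have key : ∀ v, S *ᵥ v = 0 → a *ᵥ v = 0 → v = 0 := by
      intro v h1 h2
      have h3 : (Sum.elim v 0 : Fin k ⊕ Fin k → F) = 0 := by
        apply hinj
        rw [Matrix.fromBlocks_add, Matrix.fromBlocks_mulVec]
        simp [h1, h2]
      funext i
      exact congrFun h3 (Sum.inl i)
    refine (injective_iff_map_eq_zero (Matrix.mulVecLin S)).mpr ?_
    intro v hv
    rw [Matrix.mulVecLin_apply] at hv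
    refine key v hv (key _ ?_ ?_)
    · have := congrArg (fun M => M *ᵥ v) h21
      simpa [Matrix.add_mulVec, ← Matrix.mulVec_mulVec, hv] using this
    · have := congrArg (fun M => M *ᵥ v) h11
      simpa [Matrix.add_mulVec, ← Matrix.mulVec_mulVec, hv] using this
  obtain ⟨S, rfl⟩ := hS
  refine ⟨⟨Matrix.fromBlocks ↑S⁻¹ 0 0 1, Matrix.fromBlocks ↑S 0 0 1, ?_, ?_⟩, -d, ?_, ?_⟩
  · simp [Matrix.fromBlocks_multiply]
  · simp [Matrix.fromBlocks_multiply]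
  · simp [Matrix.fromBlocks_multiply]
  · have e1 : (S : Matrix (Fin k) (Fin k) F) * a * (↑S⁻¹ : Matrix (Fin k) (Fin k) F) = -d := by
      rw [eq_neg_of_add_eq_zero_left h21, neg_mul, Units.mul_inv_cancel_right]
    have e2 : (S : Matrix (Fin k) (Fin k) F) * b = -(d ^ 2) := by
      rw [pow_two]; exact eq_neg_of_add_eq_zero_left h22
    simp [Matrix.fromBlocks_multiply, e2]
    simpa using e1
end

section
/- Let F be a field, let n, k ∈ ℕ with k < n − k, and let A ∈ M_n(F) be the block matrix with zero blocks of sizes k×k, k×(n−k), (n−k)×k and with an invertible non-derogatory matrix A₂₂ ∈ M_{n−k}(F) in the lower-right block. If there exist pairwise distinct elements α₁, …, α_n ∈ F whose sum equals the trace of A, then there exists a square-zero matrix N ∈ M_n(F) such that the characteristic polynomial of A + N equals (x − α₁)⋯(x − α_n); in particular A + N is diagonalizable with n distinct eigenvalues. -/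
open Polynomial Matrix

/-- A non-derogatory matrix has a vector with annihilator generated by the minimal polynomial. -/
theorem sz_exists_cyclic {F : Type*} [Field F] {m : ℕ} (A : Matrix (Fin m) (Fin m) F) :
    ∃ v : Fin m → F, ∀ p : F[X], aeval (toLin' A) p v = 0 → minpoly F A ∣ p := by
  obtain ⟨x, hx⟩ := Module.exists_ker_toSpanSingleton_eq_annihilator
    (R := F[X]) (M := Module.AEval' (toLin' A))
  refine ⟨(Module.AEval'.of (toLin' A)).symm x, fun p hp => ?_⟩
  have h1 : p ∈ LinearMap.ker (LinearMap.toSpanSingleton F[X] _ x) := by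
    rw [LinearMap.mem_ker, LinearMap.toSpanSingleton_apply]
    apply (Module.AEval'.of (toLin' A)).symm.injective
    rw [map_zero]
    rw [← hp]
    exact Module.AEval.of_symm_smul _ _ _
  rw [hx, Module.AEval.annihilator_eq_ker_aeval, RingHom.mem_ker] at h1
  rw [← Matrix.minpoly_toLin']
  exact minpoly.dvd _ _ h1

theorem sz_conj {F : Type*} [Field F] {ι : Type*} [Fintype ι] [DecidableEq ι]
    (U : (Matrix ι ι F)ˣ) (N : Matrix ι ι F) : (U.val * N * U⁻¹.val).charpoly = N.charpoly := by
  simp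

theorem sz_conj' {F : Type*} [Field F] {ι : Type*} [Fintype ι] [DecidableEq ι]
    (U : (Matrix ι ι F)ˣ) (N : Matrix ι ι F) : (U⁻¹.val * N * U.val).charpoly = N.charpoly := by
  simp

/-- Newton sequence of polynomials. -/
noncomputable def szSeq {F : Type*} [Field F] (s : ℕ → F) : Polynomial.Sequence F where
  elems' i := ∏ j ∈ Finset.range i, (X - C (s j))
  degree_eq' i := by
    rw [Polynomial.degree_prod]
    simp

theorem szSeq_succ {F : Type*} [Field F] (s : ℕ → F) (i : ℕ) :
    szSeq s (i + 1) = (X - C (s i)) * szSeq s i := by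
  change ∏ j ∈ Finset.range (i+1), (X - C (s j)) = _ * ∏ j ∈ Finset.range i, (X - C (s j))
  rw [Finset.prod_range_succ, mul_comm]

theorem sz_linInd {F : Type*} [Field F] {m : ℕ} (f : Module.End F (Fin m → F)) (v : Fin m → F)
    (q : F[X]) (hq : q.degree = m)
    (hv : ∀ p : F[X], aeval f p v = 0 → q ∣ p) (s : ℕ → F) :
    LinearIndependent F (fun i : Fin m => aeval f (szSeq s i) v) := by
  rw [Fintype.linearIndependent_iff]
  intro g hg
  have hlin := (szSeq s).linearIndependent.comp (fun i : Fin m => (i : ℕ)) Fin.val_injective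
  rw [Fintype.linearIndependent_iff] at hlin
  apply hlin
  have h1 : q ∣ ∑ i, g i • szSeq s (i : ℕ) := by
    apply hv
    simp only [map_sum, map_smul, LinearMap.sum_apply, LinearMap.smul_apply]
    exact hg
  refine Polynomial.eq_zero_of_dvd_of_degree_lt h1 ?_
  rw [hq, ← Polynomial.mem_degreeLT]
  refine Submodule.sum_mem _ fun i _ => Submodule.smul_mem _ _ ?_
  rw [Polynomial.mem_degreeLT, Function.comp_apply, Polynomial.Sequence.degree_eq]
  exact_mod_cast i.2

/-- The Hessenberg-type normal form. -/
def szHess {F : Type*} [Field F] {m : ℕ} (s c : Fin m → F) : Matrix (Fin m) (Fin m) F :=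
  fun i j => (if i = j then s j else 0) + (if (i : ℕ) + 1 = j then 1 else 0) +
    (if (j : ℕ) = 0 then c i else 0)

theorem sz_hess {F : Type*} [Field F] {m : ℕ} (A : Matrix (Fin m) (Fin m) F)
    (hA : minpoly F A = A.charpoly) (s : Fin m → F) (hs : ∑ i, s i = A.trace) :
    ∃ (U : (Matrix (Fin m) (Fin m) F)ˣ) (c : Fin m → F), (∀ i : Fin m, (i : ℕ) = 0 → c i = 0) ∧
      A = U.val * szHess s c * U⁻¹.val := by
  obtain ⟨v, hv⟩ := sz_exists_cyclic A
  set f := toLin' A with hf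
  let s' : ℕ → F := fun i => if h : i < m then s (Fin.rev ⟨i, h⟩) else 0
  have hlin := sz_linInd f v (minpoly F A)
    (by rw [hA, Matrix.charpoly_degree_eq_dim, Fintype.card_fin]) hv s'
  have hlin2 := hlin.comp Fin.rev Fin.rev_injective
  let b : Module.Basis (Fin m) F (Fin m → F) :=
    Module.Basis.mk hlin2 (hlin2.span_eq_top_of_card_eq_finrank' (by simp)).ge
  have hb : ∀ i, b i = aeval f (szSeq s' (Fin.rev i : Fin m)) v := by
    intro i
    simp [b]
  have hstep : ∀ i j : Fin m, (i : ℕ) + 1 = j → f (b j) = s j • b j + b i := by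
    intro i j hij
    have e : ((Fin.rev i : Fin m) : ℕ) = (Fin.rev j : Fin m) + 1 := by
      simp only [Fin.val_rev]; omega
    have e2 : s' ((Fin.rev j : Fin m) : ℕ) = s j := by
      have h1 : ((Fin.rev j : Fin m) : ℕ) < m := (Fin.rev j).2
      simp only [s', dif_pos h1, Fin.eta, Fin.rev_rev]
    rw [hb i, e, szSeq_succ, e2, map_mul, Module.End.mul_apply, ← hb j]
    simp [sub_eq_add_neg]
  let S := LinearMap.toMatrix b b f
  let c : Fin m → F := fun i => if (i : ℕ) = 0 then 0 else S i ⟨0, by have := i.2; omega⟩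
  have hcol : ∀ i j : Fin m, (j : ℕ) ≠ 0 → S i j = szHess s c i j := by
    intro i j hj
    have := hstep ⟨j - 1, by omega⟩ j (by simp; omega)
    simp only [S, LinearMap.toMatrix_apply, this, szHess, hj, if_false]
    simp only [map_add, map_smul, Finsupp.add_apply, Finsupp.smul_apply, Module.Basis.repr_self,
      Finsupp.single_apply, smul_eq_mul, Fin.ext_iff]
    grind
  have hoff : ∀ i j : Fin m, (j : ℕ) = 0 → (i : ℕ) ≠ 0 → S i j = szHess s c i j := by
    intro i j hj hi
    have hij : i ≠ j := by rintro rfl; exact hi hj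
    have : j = ⟨0, by have := i.2; omega⟩ := Fin.ext hj
    simp [szHess, hj, hij, c, hi, ← this]
  have htr : S.trace = A.trace := by
    rw [← LinearMap.trace_eq_matrix_trace F b f, hf]
    simp
  have hSS : S = szHess s c := by
    ext i j
    by_cases hj : (j : ℕ) = 0
    · by_cases hi : (i : ℕ) = 0
      · have hij : i = j := Fin.ext (by omega)
        subst hij
        have h2 : szHess s c i i = s i := by simp [szHess, c, hi]
        rw [h2]
        rw [← hs, Matrix.trace, ← Finset.add_sum_erase _ _ (Finset.mem_univ i),
          ← Finset.add_sum_erase _ s (Finset.mem_univ i)] at htr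
        have : ∑ x ∈ Finset.univ.erase i, S.diag x = ∑ x ∈ Finset.univ.erase i, s x := by
          refine Finset.sum_congr rfl fun x hx => ?_
          have hx' : (x : ℕ) ≠ 0 := fun h => (Finset.ne_of_mem_erase hx) (Fin.ext (by omega))
          rw [Matrix.diag_apply, hcol x x hx']
          simp [szHess, hx']
        rw [this] at htr
        exact add_right_cancel htr
      · exact hoff i j hj hi
    · exact hcol i j hj
  let e := Pi.basisFun F (Fin m)
  refine ⟨⟨e.toMatrix b, b.toMatrix e, e.toMatrix_mul_toMatrix_flip b,
    b.toMatrix_mul_toMatrix_flip e⟩, c, fun i hi => by simp [c, hi], ?_⟩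
  rw [← hSS]
  change A = e.toMatrix b * LinearMap.toMatrix b b f * b.toMatrix e
  rw [basis_toMatrix_mul_linearMap_toMatrix_mul_basis_toMatrix]
  exact (LinearMap.toMatrix'_toLin' A).symm

/-- Case `k = 0`-type statement. -/
theorem sz_zero {F : Type*} [Field F] {m : ℕ} (A : Matrix (Fin m) (Fin m) F)
    (hA : minpoly F A = A.charpoly) (s : Fin m → F) (hs : ∑ i, s i = A.trace) :
    ∃ N : Matrix (Fin m) (Fin m) F, N * N = 0 ∧ (A + N).charpoly = ∏ i, (X - C (s i)) := by
  obtain ⟨U, c, hc, hU⟩ := sz_hess A hA s hs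
  let N : Matrix (Fin m) (Fin m) F := fun i j => if (j : ℕ) = 0 then - c i else 0
  have hN : N * N = 0 := by
    ext i j
    rw [Matrix.mul_apply]
    refine Finset.sum_eq_zero fun x _ => ?_
    by_cases hx : (x : ℕ) = 0
    · simp [N, hx, hc x hx]
    · simp [N, hx]
  refine ⟨U.val * N * U⁻¹.val, ?_, ?_⟩
  · calc U.val * N * U⁻¹.val * (U.val * N * U⁻¹.val)
        = U.val * N * (U⁻¹.val * U.val) * N * U⁻¹.val := by simp only [Matrix.mul_assoc]
      _ = U.val * (N * N) * U⁻¹.val := by rw [Units.inv_mul]; simp only [Matrix.mul_assoc, Matrix.one_mul]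
      _ = 0 := by rw [hN]; simp
  · conv_lhs => rw [hU, ← Matrix.add_mul, ← Matrix.mul_add]
    rw [sz_conj, charpoly_of_isUpperTriangular]
    · refine Finset.prod_congr rfl fun i _ => ?_
      congr 2
      rw [Matrix.add_apply]
      by_cases hi : (i : ℕ) = 0 <;> simp [szHess, N, hi]
    · intro i j hij
      have h1 : (j : ℕ) < i := hij
      have h2 : i ≠ j := by rintro rfl; omega
      have h3 : (i : ℕ) + 1 ≠ j := by omega
      rw [Matrix.add_apply]
      by_cases hi : (j : ℕ) = 0 <;> simp [szHess, N, hi, h2, h3]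

/-- Case `1 ≤ k`: decomposition `A = B + X Z`. -/
theorem sz_pos {F : Type*} [Field F] {m k : ℕ} (hk : 0 < k) (hkm : k ≤ m)
    (A : Matrix (Fin m) (Fin m) F)
    (hA : minpoly F A = A.charpoly) (β : Fin m → F) (γ : Fin k → F)
    (hs : ∑ i, γ i + ∑ i, β i = A.trace) :
    ∃ (B : Matrix (Fin m) (Fin m) F) (Y : Matrix (Fin m) (Fin k) F) (Z : Matrix (Fin k) (Fin m) F),
      A = B + Y * Z ∧ (Z * Y).charpoly = ∏ i, (X - C (γ i)) ∧
      B.charpoly = ∏ i, (X - C (β i)) := by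
  let γ' : Fin m → F := fun i => if h : (i : ℕ) < k then γ ⟨i, h⟩ else 0
  have hγ : ∑ i, γ' i = ∑ i, γ i := by
    symm
    refine Finset.sum_of_injOn (Fin.castLE hkm) (fun _ _ _ _ h => Fin.castLE_injective hkm h)
      (fun _ _ => by simp) ?_ ?_
    · intro i _ hi
      have : ¬ (i : ℕ) < k := fun h => hi ⟨⟨i, h⟩, by simp, Fin.ext rfl⟩
      simp [γ', this]
    · intro i _
      simp [γ']
  obtain ⟨U, c, hc, hU⟩ := sz_hess A hA (fun i => γ' i + β i)
    (by rw [Finset.sum_add_distrib, hγ, hs])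
  let B : Matrix (Fin m) (Fin m) F :=
    fun i j => (if i = j then β j else 0) + (if (i : ℕ) + 1 = j then 1 else 0)
  let R : Matrix (Fin m) (Fin m) F :=
    fun i j => (if i = j then γ' j else 0) + (if (j : ℕ) = 0 then c i else 0)
  let Y : Matrix (Fin m) (Fin k) F := R.submatrix id (Fin.castLE hkm)
  let Z : Matrix (Fin k) (Fin m) F := (1 : Matrix (Fin m) (Fin m) F).submatrix (Fin.castLE hkm) id
  have hZY : Z * Y = R.submatrix (Fin.castLE hkm) (Fin.castLE hkm) := by
    ext a b
    simp [Z, Y, Matrix.mul_apply, Matrix.one_apply]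
  have hYZ : Y * Z = R := by
    ext i j
    rw [Matrix.mul_apply]
    by_cases hj : (j : ℕ) < k
    · rw [Finset.sum_eq_single ⟨j, hj⟩]
      · have : Fin.castLE hkm ⟨j, hj⟩ = j := Fin.ext rfl
        change R i (Fin.castLE hkm ⟨j, hj⟩) *
          (1 : Matrix (Fin m) (Fin m) F) (Fin.castLE hkm ⟨j, hj⟩) j = R i j
        rw [this, Matrix.one_apply_eq, mul_one]
      · intro a _ ha
        have : Fin.castLE hkm a ≠ j := by
          rintro rfl; exact ha (Fin.ext rfl)
        simp [Y, Z, this]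
      · simp
    · rw [Finset.sum_eq_zero]
      · have : (j : ℕ) ≠ 0 := by omega
        simp [R, γ', hj, this]
      · intro a _
        have : Fin.castLE hkm a ≠ j := by
          rintro rfl; exact hj a.2
        simp [Y, Z, this]
  have hS : szHess (fun i => γ' i + β i) c = B + Y * Z := by
    rw [hYZ]
    ext i j
    rw [Matrix.add_apply]
    simp only [szHess, B, R]
    split_ifs <;> ring
  refine ⟨U.val * B * U⁻¹.val, U.val * Y, Z * U⁻¹.val, ?_, ?_, ?_⟩
  · rw [hU, hS, Matrix.mul_add, Matrix.add_mul]
    simp only [Matrix.mul_assoc]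
  · have : Z * U⁻¹.val * (U.val * Y) = Z * Y := by
      calc _ = Z * (U⁻¹.val * U.val) * Y := by simp only [Matrix.mul_assoc]
        _ = _ := by rw [Units.inv_mul, Matrix.mul_one]
    rw [this, hZY, ← Matrix.charpoly_transpose, charpoly_of_isUpperTriangular]
    · refine Finset.prod_congr rfl fun i _ => ?_
      congr 2
      rw [Matrix.transpose_apply, Matrix.submatrix_apply]
      have e1 : γ' (Fin.castLE hkm i) = γ i := by simp [γ']
      by_cases hi : (i : ℕ) = 0 <;> simp [R, e1, hi, hc]
    · intro i j hij
      have h1 : (j : ℕ) < i := hij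
      have h2 : Fin.castLE hkm j ≠ Fin.castLE hkm i := by
        intro h; have := congrArg Fin.val h; simp at this; omega
      have h3 : (i : ℕ) ≠ 0 := by omega
      rw [Matrix.transpose_apply, Matrix.submatrix_apply]
      simp [R, h2, h3]
  · rw [sz_conj, charpoly_of_isUpperTriangular]
    · simp [B]
    · intro i j hij
      have h1 : (j : ℕ) < i := hij
      have h2 : i ≠ j := by rintro rfl; omega
      have h3 : (i : ℕ) + 1 ≠ j := by omega
      simp [B, h2, h3]

theorem sz_block {F : Type*} [Field F] {m k : ℕ}
    (A B : Matrix (Fin m) (Fin m) F) (hInv : IsUnit A)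
    (Y : Matrix (Fin m) (Fin k) F) (Z : Matrix (Fin k) (Fin m) F) (hA : A = B + Y * Z) :
    ∃ N : Matrix (Fin k ⊕ Fin m) (Fin k ⊕ Fin m) F, N * N = 0 ∧
      (fromBlocks 0 0 0 A + N).charpoly = (Z * Y).charpoly * B.charpoly := by
  obtain ⟨u, rfl⟩ := hInv
  let W : Matrix (Fin m) (Fin k) F := u⁻¹.val * Y
  have hW : u.val * W = Y := by
    simp only [W]
    rw [← Matrix.mul_assoc, Units.mul_inv, Matrix.one_mul]
  let G1 : (Matrix (Fin k ⊕ Fin m) (Fin k ⊕ Fin m) F)ˣ :=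
    ⟨fromBlocks 1 Z 0 1, fromBlocks 1 (-Z) 0 1,
      by simp [fromBlocks_multiply], by simp [fromBlocks_multiply]⟩
  let G2 : (Matrix (Fin k ⊕ Fin m) (Fin k ⊕ Fin m) F)ˣ :=
    ⟨fromBlocks 1 0 (-W) 1, fromBlocks 1 0 W 1,
      by simp [fromBlocks_multiply], by simp [fromBlocks_multiply]⟩
  let G := G1 * G2
  let A' : Matrix (Fin k ⊕ Fin m) (Fin k ⊕ Fin m) F := fromBlocks (Z * Y) (Z * B) Y B
  let N' : Matrix (Fin k ⊕ Fin m) (Fin k ⊕ Fin m) F := fromBlocks 0 0 (-Y) 0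
  have hN : N' * N' = 0 := by simp [N', fromBlocks_multiply]
  have hG : G.val * fromBlocks 0 0 0 u.val = A' * G.val := by
    have h1 : A' * G1.val = fromBlocks (Z * Y) (Z * u.val) Y u.val := by
      simp only [A', G1, fromBlocks_multiply, Matrix.mul_one, Matrix.mul_zero, add_zero]
      rw [Matrix.mul_assoc, ← Matrix.mul_add, add_comm (Y * Z), ← hA]
    have h2 : A' * G.val = fromBlocks 0 (Z * u.val) 0 u.val := by
      simp only [G, Units.val_mul]
      rw [← Matrix.mul_assoc, h1]
      simp only [G2, fromBlocks_multiply, Matrix.mul_one, Matrix.mul_zero, zero_add, Matrix.mul_neg,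
        Matrix.mul_assoc, hW, add_neg_cancel]
    rw [h2]
    simp [G, G1, G2, fromBlocks_multiply]
  have hG' : fromBlocks 0 0 0 u.val = G⁻¹.val * A' * G.val := by
    rw [Matrix.mul_assoc, ← hG, ← Matrix.mul_assoc, Units.inv_mul, Matrix.one_mul]
  refine ⟨G⁻¹.val * N' * G.val, ?_, ?_⟩
  · calc G⁻¹.val * N' * G.val * (G⁻¹.val * N' * G.val)
        = G⁻¹.val * N' * (G.val * G⁻¹.val) * N' * G.val := by simp only [Matrix.mul_assoc]
      _ = G⁻¹.val * (N' * N') * G.val := by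
          rw [Units.mul_inv]; simp only [Matrix.mul_assoc, Matrix.one_mul]
      _ = 0 := by rw [hN]; simp
  · rw [hG', ← Matrix.add_mul, ← Matrix.mul_add, sz_conj']
    simp [A', N', fromBlocks_add]

theorem sz_diag {F : Type*} [Field F] {ι : Type*} [Fintype ι] [DecidableEq ι]
    (M : Matrix ι ι F) (d : ι → F) (hd : Function.Injective d)
    (hM : M.charpoly = ∏ i, (X - C (d i))) :
    ∃ P : (Matrix ι ι F)ˣ, P⁻¹.val * M * P.val = Matrix.diagonal d := by
  have h1 : ∀ i, ∃ v, Module.End.HasEigenvector (toLin' M) (d i) v := by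
    intro i
    apply Module.End.HasEigenvalue.exists_hasEigenvector
    rw [Module.End.hasEigenvalue_iff_isRoot_charpoly, Matrix.charpoly_toLin', hM,
      Polynomial.IsRoot.def, Polynomial.eval_prod]
    exact Finset.prod_eq_zero (Finset.mem_univ i) (by simp)
  choose v hv using h1
  have hlin := Module.End.eigenvectors_linearIndependent' (toLin' M) d hd v hv
  let P : Matrix ι ι F := fun i j => v j i
  have hP : IsUnit P := by
    rw [← Matrix.linearIndependent_cols_iff_isUnit]
    exact hlin
  obtain ⟨u, hu⟩ := hP
  refine ⟨u, ?_⟩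
  have : M * u.val = u.val * Matrix.diagonal d := by
    rw [hu]
    ext i j
    have := congrFun (hv j).apply_eq_smul i
    rw [Matrix.mul_diagonal]
    rw [toLin'_apply] at this
    rw [mul_comm]
    exact this
  rw [Matrix.mul_assoc, this, ← Matrix.mul_assoc, Units.inv_mul, Matrix.one_mul]

theorem squareZero_plus_diagonalizable
    (F : Type*) [Field F] (n k : ℕ) (hk : k < n - k)
    (A₂₂ : Matrix (Fin (n - k)) (Fin (n - k)) F)
    (hInv : IsUnit A₂₂)
    (hNonDerog : minpoly F A₂₂ = A₂₂.charpoly)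
    (A : Matrix (Fin k ⊕ Fin (n - k)) (Fin k ⊕ Fin (n - k)) F)
    (hA : A = Matrix.fromBlocks 0 0 0 A₂₂)
    (α : Fin n → F) (hαinj : Function.Injective α)
    (hαsum : ∑ i, α i = A.trace) :
    ∃ N : Matrix (Fin k ⊕ Fin (n - k)) (Fin k ⊕ Fin (n - k)) F,
      N ^ 2 = 0 ∧
      (A + N).charpoly = ∏ i, (X - C (α i)) ∧
      ∃ d : Fin k ⊕ Fin (n - k) → F, Function.Injective d ∧
        ∃ P : (Matrix (Fin k ⊕ Fin (n - k)) (Fin k ⊕ Fin (n - k)) F)ˣ,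
          (↑P⁻¹ : Matrix (Fin k ⊕ Fin (n - k)) (Fin k ⊕ Fin (n - k)) F) * (A + N)
              * (↑P : Matrix (Fin k ⊕ Fin (n - k)) (Fin k ⊕ Fin (n - k)) F)
            = Matrix.diagonal d := by
  let e : Fin k ⊕ Fin (n - k) ≃ Fin n := finSumFinEquiv.trans (finCongr (by omega))
  let d : Fin k ⊕ Fin (n - k) → F := α ∘ e
  have hd : Function.Injective d := hαinj.comp e.injective
  have hprod : ∏ i, (X - C (α i)) = ∏ i, (X - C (d i)) :=
    (Equiv.prod_comp e (fun i => X - C (α i))).symm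
  have hsum : ∑ i, d (Sum.inl i) + ∑ i, d (Sum.inr i) = A₂₂.trace := by
    rw [← Fintype.sum_sum_type d, show ∑ x, d x = ∑ x, α x from Equiv.sum_comp e α, hαsum, hA]
    simp [Matrix.trace]
  have main : ∃ N : Matrix (Fin k ⊕ Fin (n - k)) (Fin k ⊕ Fin (n - k)) F,
      N * N = 0 ∧ (A + N).charpoly = ∏ i, (X - C (d i)) := by
    rw [Fintype.prod_sum_type, hA]
    rcases Nat.eq_zero_or_pos k with h0 | hpos
    · haveI : IsEmpty (Fin k) := by rw [h0]; infer_instance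
      obtain ⟨N, hN, hc⟩ := sz_zero A₂₂ hNonDerog (fun i => d (Sum.inr i)) (by simpa using hsum)
      refine ⟨fromBlocks 0 0 0 N, by simp [fromBlocks_multiply, hN], ?_⟩
      simp [fromBlocks_add, hc]
    · obtain ⟨B, Y, Z, h1, h2, h3⟩ := sz_pos hpos hk.le A₂₂ hNonDerog _ _ hsum
      obtain ⟨N, hN, hc⟩ := sz_block A₂₂ B hInv Y Z h1
      exact ⟨N, hN, by rw [hc, h2, h3]⟩
  obtain ⟨N, hN, hc⟩ := main
  exact ⟨N, by rw [pow_two, hN], by rw [hc, hprod], d, hd, sz_diag _ d hd hc⟩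
end

section
/- Let F be a field, let n, k ∈ ℕ with n ≥ 3 and k < n − k, and let A ∈ M_n(F) be the block matrix with zero blocks of sizes k×k, k×(n−k), (n−k)×k and with an invertible non-derogatory matrix A₂₂ ∈ M_{n−k}(F) in the lower-right block. If the trace of A is zero, then there exist an n-potent matrix P ∈ M_n(F) (i.e. Pⁿ = P) and a square-zero matrix N₁ ∈ M_n(F) such that A = P + N₁. -/
open Matrix

open Polynomial in
theorem aux_indep {F : Type*} [Field F] (k : ℕ) : ∀ (l : ℕ → F[X]) (q : F[X]),
    (∀ i, (l i).degree < 2) →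
    (∑ i ∈ Finset.range k, l i * (X ^ (2 * i) * (X - 1) ^ (k - 1 - i))) + X ^ (2 * k) * q = 0 →
    (∀ i < k, l i = 0) ∧ q = 0 := by
  induction k with
  | zero =>
    intro l q _ h
    simpa using h
  | succ k ih =>
    intro l q hl h
    rw [Finset.sum_range_succ'] at h
    have e : ∀ i ∈ Finset.range k, l (i+1) * (X ^ (2 * (i+1)) * (X - 1) ^ (k + 1 - 1 - (i+1)))
        = X ^ 2 * (l (i+1) * (X ^ (2 * i) * (X - 1 : F[X]) ^ (k - 1 - i))) := by
      intro i _
      have : k + 1 - 1 - (i+1) = k - 1 - i := by omega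
      rw [this]; ring
    rw [Finset.sum_congr rfl e, ← Finset.mul_sum] at h
    have h2 : X ^ 2 * ((∑ i ∈ Finset.range k, l (i+1) * (X ^ (2 * i) * (X - 1) ^ (k - 1 - i)))
        + X ^ (2 * k) * q) + l 0 * (X - 1) ^ k = 0 := by
      rw [← h]; simp; ring
    have hd : (X ^ 2 : F[X]) ∣ l 0 * (X - 1) ^ k := by
      refine (dvd_add_right (Dvd.intro _ rfl)).mp (h2 ▸ dvd_zero _)
    have hc : IsCoprime (X ^ 2 : F[X]) ((X - 1) ^ k) := by
      apply IsCoprime.pow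
      exact ⟨1, -1, by ring⟩
    have h0 : l 0 = 0 := by
      refine eq_zero_of_dvd_of_degree_lt (hc.dvd_of_dvd_mul_right hd) ?_
      simpa using hl 0
    rw [h0, zero_mul, add_zero] at h2
    have h3 := (mul_eq_zero.mp h2).resolve_left (pow_ne_zero _ X_ne_zero)
    obtain ⟨h4, h5⟩ := ih (fun i => l (i+1)) q (fun i => hl _) h3
    refine ⟨fun i hi => ?_, h5⟩
    cases i with
    | zero => exact h0
    | succ i => exact h4 i (by omega)

open Polynomial in
theorem aux_cyclic {F : Type*} [Field F] (m : ℕ) (A : Matrix (Fin m) (Fin m) F)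
    (h : minpoly F A = A.charpoly) :
    ∃ U V C : Matrix (Fin m) (Fin m) F, U * V = 1 ∧ A = U * C * V ∧
      (∀ i j : Fin m, j.1 + 1 < m → C i j = if i.1 = j.1 + 1 then 1 else 0) := by
  set φ : Module.End F (Fin m → F) := Matrix.toLin' A with hφ
  obtain ⟨x, hx⟩ := Module.exists_ker_toSpanSingleton_eq_annihilator (R := F[X])
    (M := Module.AEval' φ)
  rw [← span_minpoly_eq_annihilator, hφ, Matrix.minpoly_toLin', h] at hx
  let y : Fin m → F := (Module.AEval'.of φ).symm x
  have hy : ∀ p : F[X], aeval φ p y = 0 → A.charpoly ∣ p := by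
    intro p hp
    rw [← Ideal.mem_span_singleton, ← hx, LinearMap.mem_ker, LinearMap.toSpanSingleton_apply]
    exact hp
  have li : LinearIndependent F (fun j : Fin m => (φ ^ j.1) y) := by
    rw [Fintype.linearIndependent_iff]
    intro g hg
    let p : F[X] := ∑ j : Fin m, C (g j) * X ^ j.1
    have hp : aeval φ p y = 0 := by
      rw [← hg]
      simp [p, LinearMap.sum_apply]
    have hp0 : p = 0 := by
      refine eq_zero_of_dvd_of_degree_lt (hy p hp) ?_
      rw [Matrix.charpoly_degree_eq_dim, Fintype.card_fin]
      exact degree_sum_fin_lt g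
    intro i
    have : p.coeff i = g i := by
      simp only [p, finsetSum_coeff, coeff_C_mul, coeff_X_pow]
      rw [Finset.sum_eq_single i]
      · simp
      · intro b _ hb
        rw [if_neg (fun h => hb (Fin.ext h.symm)), mul_zero]
      · simp
    rw [← this, hp0, coeff_zero]
  let e := basisOfLinearIndependentOfCardEqFinrank' _ li (by simp)
  have he : ∀ j, e j = (φ ^ j.1) y := fun j => by simp [e]
  let b := Pi.basisFun F (Fin m)
  refine ⟨b.toMatrix e, e.toMatrix b, LinearMap.toMatrix e e φ, b.toMatrix_mul_toMatrix_flip e, ?_, ?_⟩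
  · rw [basis_toMatrix_mul_linearMap_toMatrix_mul_basis_toMatrix, hφ]
    exact (LinearMap.toMatrix'_toLin' A).symm
  · intro i j hj
    rw [LinearMap.toMatrix_apply, he]
    have : φ ((φ ^ j.1) y) = e ⟨j.1 + 1, hj⟩ := by
      rw [he, pow_succ']; rfl
    rw [this, Module.Basis.repr_self, Finsupp.single_apply]
    simp only [Fin.ext_iff, eq_comm]

theorem aux_final {F : Type*} [Field F] (k m : ℕ) (A C : Matrix (Fin m) (Fin m) F)
    (U V : Matrix (Fin m) (Fin m) F) (hUV : U * V = 1) (hA : A = U * C * V) (hu : IsUnit A)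
    (hC : ∀ i j : Fin m, j.1 + 1 < m → C i j = if i.1 = j.1 + 1 then 1 else 0)
    (htr : A.trace = 0) (n : ℕ)
    (P : Matrix (Fin k ⊕ Fin m) (Fin k ⊕ Fin m) F) (hP : P ^ n = P)
    (h1 : P.toBlocks₁₁ = 0)
    (h2 : ∀ (i : Fin m) j, i.1 + 1 = m → P.toBlocks₂₁ i j = 0)
    (h3 : ∀ i j : Fin m, j.1 + 1 < m → P.toBlocks₂₂ i j = if i.1 = j.1 + 1 then 1 else 0)
    (h4 : P.trace = 0) :
    ∃ Q N : Matrix (Fin k ⊕ Fin m) (Fin k ⊕ Fin m) F,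
      Q ^ n = Q ∧ N ^ 2 = 0 ∧ Matrix.fromBlocks 0 0 0 A = Q + N := by
  have hVU : V * U = 1 := mul_eq_one_comm.mp hUV
  have hCA : C = V * A * U := by
    rw [hA]
    calc C = 1 * C * 1 := by simp
      _ = (V * U) * C * (V * U) := by rw [hVU]
      _ = _ := by simp only [Matrix.mul_assoc]
  have hCu : IsUnit C := by
    rw [hCA]
    exact ((IsUnit.of_mul_eq_one _ hVU).mul hu).mul (IsUnit.of_mul_eq_one _ hUV)
  have hCtr : C.trace = 0 := by
    rw [hCA, Matrix.trace_mul_comm, ← Matrix.mul_assoc, hUV, Matrix.one_mul, htr]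
  have hdet : IsUnit C.det := (Matrix.isUnit_iff_isUnit_det C).mp hCu
  set B := P.toBlocks₁₂
  set G := P.toBlocks₂₁
  set D := P.toBlocks₂₂
  have hPb : P = fromBlocks 0 B G D := by
    rw [← h1]; exact (fromBlocks_toBlocks P).symm
  have hDtr : D.trace = 0 := by
    rw [hPb, Matrix.trace, Fintype.sum_sum_type] at h4
    simpa [Matrix.trace] using h4
  have last : ∀ M : Matrix (Fin m) (Fin m) F, M.trace = 0 →
      (∀ i j : Fin m, j.1 + 1 < m → M i j = if i.1 = j.1 + 1 then 1 else 0) →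
      ∀ i : Fin m, i.1 + 1 = m → M i i = 0 := by
    intro M hM hM2 i hi
    rw [← hM, Matrix.trace, Finset.sum_eq_single i]
    · rfl
    · intro j _ hj
      have : j.1 + 1 < m := by
        have := j.2
        have : j.1 ≠ i.1 := fun h => hj (Fin.ext h)
        omega
      rw [Matrix.diag_apply, hM2 _ _ this, if_neg (by omega)]
    · simp
  have hE : ∀ i j : Fin m, (C - D) i j ≠ 0 → i.1 + 1 ≠ m ∧ j.1 + 1 = m := by
    intro i j hij
    have hj : j.1 + 1 = m := by
      by_contra hj
      have : j.1 + 1 < m := by omega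
      exact hij (by rw [Matrix.sub_apply, hC _ _ this, h3 _ _ this, sub_self])
    refine ⟨fun hi => hij ?_, hj⟩
    have : i = j := Fin.ext (by omega)
    subst this
    rw [Matrix.sub_apply, last C hCtr hC _ hi, last D hDtr h3 _ hi, sub_self]
  have hEE : (C - D) * (C - D) = 0 := by
    ext i j
    rw [Matrix.mul_apply, Matrix.zero_apply]
    refine Finset.sum_eq_zero fun l _ => ?_
    by_contra hne
    have ⟨a, b⟩ := mul_ne_zero_iff.mp hne
    exact (hE _ _ b).1 (hE _ _ a).2
  have hEG : (C - D) * G = 0 := by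
    ext i j
    rw [Matrix.mul_apply, Matrix.zero_apply]
    refine Finset.sum_eq_zero fun l _ => ?_
    by_contra hne
    have ⟨a, b⟩ := mul_ne_zero_iff.mp hne
    exact b (h2 _ _ (hE _ _ a).2)
  let N0 : Matrix (Fin k ⊕ Fin m) (Fin k ⊕ Fin m) F := fromBlocks 0 0 (-G) (C - D)
  have hN0 : N0 * N0 = 0 := by
    simp [N0, fromBlocks_multiply, hEE, hEG]
  have hA' : P + N0 = fromBlocks 0 B 0 C := by
    rw [hPb]; simp [N0, fromBlocks_add]
  -- conjugating matrices
  let S : Matrix (Fin k ⊕ Fin m) (Fin k ⊕ Fin m) F := fromBlocks 1 (-(B * C⁻¹)) 0 U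
  let T : Matrix (Fin k ⊕ Fin m) (Fin k ⊕ Fin m) F := fromBlocks 1 (B * C⁻¹ * V) 0 V
  have hTS : T * S = 1 := by
    simp [T, S, fromBlocks_multiply, Matrix.mul_assoc, hVU]
  have hconj : S * fromBlocks 0 B 0 C * T = fromBlocks 0 0 0 A := by
    simp [T, S, fromBlocks_multiply, Matrix.mul_assoc, hA, Matrix.nonsing_inv_mul _ hdet]
  have hpow : ∀ r : ℕ, (S * P * T) ^ (r + 1) = S * P ^ (r + 1) * T := by
    intro r
    induction r with
    | zero => simp
    | succ r ih =>
      rw [pow_succ, ih, pow_succ P (r+1)]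
      calc S * P ^ (r + 1) * T * (S * P * T) = S * P ^ (r + 1) * (T * S) * P * T := by
            simp only [Matrix.mul_assoc]
        _ = _ := by rw [hTS]; simp only [Matrix.mul_assoc, Matrix.one_mul]
  refine ⟨S * P * T, S * N0 * T, ?_, ?_, ?_⟩
  · cases n with
    | zero =>
      rw [pow_zero] at hP ⊢
      rw [← hP, Matrix.mul_one, mul_eq_one_comm.mp hTS]
    | succ n => rw [hpow, hP]
  · rw [pow_two]
    calc S * N0 * T * (S * N0 * T) = S * (N0 * (T * S) * N0) * T := by
          simp only [Matrix.mul_assoc]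
      _ = 0 := by rw [hTS, Matrix.mul_one, hN0]; simp
  · rw [← hconj, ← hA', Matrix.mul_add, Matrix.add_mul]

open Polynomial in
theorem aux_P {F : Type*} [Field F] (k m : ℕ) (hk : k < m) (hn : 3 ≤ m + k) :
    ∃ P : Matrix (Fin k ⊕ Fin m) (Fin k ⊕ Fin m) F, P ^ (m + k) = P ∧
      P.toBlocks₁₁ = 0 ∧
      (∀ (i : Fin m) j, i.1 + 1 = m → P.toBlocks₂₁ i j = 0) ∧
      (∀ i j : Fin m, j.1 + 1 < m → P.toBlocks₂₂ i j = if i.1 = j.1 + 1 then 1 else 0) ∧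
      P.trace = 0 := by
  obtain ⟨R, rfl⟩ := Nat.exists_eq_add_of_le hk.le
  let g : F[X] := X ^ (k + R + k) - X
  have hdl : (X : F[X]).degree < ((k + R + k : ℕ) : WithBot ℕ) := by
    rw [degree_X]; exact_mod_cast (by omega : 1 < k + R + k)
  have hg : g.Monic := monic_X_pow_sub (by rw [degree_X]; exact_mod_cast (by omega)) |> fun h => h
  have hgd : g.degree = ((k + R + k : ℕ) : WithBot ℕ) := by
    simp only [g]
    rw [degree_sub_eq_left_of_degree_lt (by simpa using hdl), degree_X_pow]
  have hgn : g.natDegree = k + R + k := natDegree_eq_of_degree_eq_some hgd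
  let κ : ℕ → F[X] := fun i => X ^ (2 * i) * (X - 1) ^ (k - 1 - i)
  let s : ℕ → F[X] := fun i => if i < k then X * κ i else X ^ (k + i)
  let v : Fin k ⊕ Fin (k + R) → AdjoinRoot g :=
    Sum.elim (fun i => AdjoinRoot.mk g (κ i)) (fun i => AdjoinRoot.mk g (s i))
  have hκd : ∀ i < k, (κ i).degree ≤ ((2 * k - 2 : ℕ) : WithBot ℕ) := by
    intro i hi
    have hm : (κ i).natDegree ≤ 2 * i + (k - 1 - i) := by
      refine natDegree_mul_le_of_le (natDegree_X_pow_le _) ?_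
      refine (natDegree_pow_le_of_le (n := k - 1 - i) (m := 1) ?_).trans (by simp)
      exact (natDegree_X_sub_C (1 : F) ▸ (by simp))
    exact degree_le_of_natDegree_le (hm.trans (by omega))
  have hsd : ∀ i < k + R, (s i).degree < ((k + R + k : ℕ) : WithBot ℕ) := by
    intro i hi
    simp only [s]
    split_ifs with h
    · rw [degree_mul, degree_X]
      calc (1 : WithBot ℕ) + (κ i).degree ≤ 1 + ((2 * k - 2 : ℕ) : WithBot ℕ) := by
            gcongr; exact hκd i h
        _ < _ := by exact_mod_cast (by omega : 1 + (2 * k - 2) < k + R + k)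
    · rw [degree_X_pow]; exact_mod_cast (by omega)
  have li : LinearIndependent F v := by
    rw [Fintype.linearIndependent_iff]
    intro c hc
    let c1 : ℕ → F := fun i => if h : i < k then c (Sum.inl ⟨i, h⟩) else 0
    let c2 : ℕ → F := fun i => if h : i < k + R then c (Sum.inr ⟨i, h⟩) else 0
    have hc1 : ∀ i : Fin k, c (Sum.inl i) = c1 i := fun i => by simp [c1]
    have hc2 : ∀ i : Fin (k + R), c (Sum.inr i) = c2 i := fun i => by
      simp only [c2]; rw [dif_pos i.2]
    let p : F[X] := ∑ i ∈ Finset.range k, C (c1 i) * κ i +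
      ∑ i ∈ Finset.range (k + R), C (c2 i) * s i
    have hp : AdjoinRoot.mk g p = 0 := by
      rw [← hc, Fintype.sum_sum_type]
      simp only [hc1, hc2, v, Sum.elim_inl, Sum.elim_inr]
      rw [Fin.sum_univ_eq_sum_range (fun i => c1 i • AdjoinRoot.mk g (κ i)),
        Fin.sum_univ_eq_sum_range (fun i => c2 i • AdjoinRoot.mk g (s i))]
      simp only [p, map_add, map_sum, AdjoinRoot.smul_mk, smul_eq_C_mul]
    have hp0 : p = 0 := by
      refine eq_zero_of_dvd_of_degree_lt (AdjoinRoot.mk_eq_zero.mp hp) ?_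
      rw [hgd, ← mem_degreeLT]
      refine Submodule.add_mem _ (Submodule.sum_mem _ fun i hi => ?_)
        (Submodule.sum_mem _ fun i hi => ?_)
      · rw [← smul_eq_C_mul]
        refine Submodule.smul_mem _ _ (mem_degreeLT.mpr ?_)
        have hi := Finset.mem_range.mp hi
        refine (hκd i hi).trans_lt ?_
        exact_mod_cast (by omega : 2 * k - 2 < k + R + k)
      · rw [← smul_eq_C_mul]
        exact Submodule.smul_mem _ _ (mem_degreeLT.mpr (hsd i (Finset.mem_range.mp hi)))
    have hsplit : (∑ i ∈ Finset.range k, (C (c1 i) + C (c2 i) * X) *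
        (X ^ (2 * i) * (X - 1) ^ (k - 1 - i))) +
        X ^ (2 * k) * (∑ i ∈ Finset.range R, C (c2 (k + i)) * X ^ i) = 0 := by
      rw [← hp0]
      simp only [p]
      rw [Finset.sum_range_add, ← add_assoc, ← Finset.sum_add_distrib, Finset.mul_sum]
      congr 1
      · refine Finset.sum_congr rfl fun i hi => ?_
        have hi := Finset.mem_range.mp hi
        simp only [s, κ, if_pos hi]; ring
      · refine Finset.sum_congr rfl fun i hi => ?_
        simp only [s]
        rw [if_neg (by omega)]; ring
    obtain ⟨r1, r2⟩ := aux_indep k _ _ (fun i => by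
      refine lt_of_le_of_lt (b := (1 : WithBot ℕ)) ?_ (by exact_mod_cast one_lt_two)
      rw [add_comm]; exact degree_linear_le) hsplit
    have q1 : ∀ i < k, c1 i = 0 := fun i hi => by
      simpa using congrArg (fun p => coeff p 0) (r1 i hi)
    have q2 : ∀ i < k, c2 i = 0 := fun i hi => by
      simpa [coeff_C] using congrArg (fun p => coeff p 1) (r1 i hi)
    have q3 : ∀ i < R, c2 (k + i) = 0 := fun i hi => by
      have := congrArg (fun p => coeff p i) r2
      simp only [finsetSum_coeff, coeff_C_mul, coeff_X_pow, coeff_zero] at this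
      simpa [hi] using this
    rintro (i | i)
    · rw [hc1]; exact q1 i i.2
    · rw [hc2]
      by_cases hi : i.1 < k
      · exact q2 _ hi
      · have := q3 (i.1 - k) (by omega)
        rwa [Nat.add_sub_cancel' (by omega)] at this
  have hfr : Module.finrank F (AdjoinRoot g) = k + R + k := by
    rw [(AdjoinRoot.powerBasis' hg).finrank, AdjoinRoot.powerBasis'_dim, hgn]
  have : Module.Finite F (AdjoinRoot g) := hg.finite_adjoinRoot
  let b := basisOfLinearIndependentOfCardEqFinrank' v li (by
    rw [hfr]; simp; omega)
  have hb : ⇑b = v := by simp [b]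
  have hmul : ∀ j i, Algebra.leftMulMatrix b (AdjoinRoot.root g) i j =
      b.repr (AdjoinRoot.root g * v j) i := by
    intro j i
    rw [Algebra.leftMulMatrix_eq_repr_mul, hb]
  have hroot : ∀ p : F[X], AdjoinRoot.root g * AdjoinRoot.mk g p = AdjoinRoot.mk g (X * p) := by
    intro p; rw [map_mul, AdjoinRoot.mk_X]
  have hinl : ∀ j : Fin k, AdjoinRoot.root g * v (Sum.inl j) =
      b (Sum.inr ⟨j.1, by omega⟩) := by
    intro j
    rw [hb]
    simp only [v, Sum.elim_inl, Sum.elim_inr, hroot, s, if_pos j.2]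
  refine ⟨Algebra.leftMulMatrix b (AdjoinRoot.root g), ?_, ?_, ?_, ?_, ?_⟩
  · rw [← map_pow]
    congr 1
    have : AdjoinRoot.mk g g = 0 := AdjoinRoot.mk_self
    simp only [g, map_sub, map_pow, AdjoinRoot.mk_X] at this
    exact sub_eq_zero.mp this
  · ext i j
    simp only [toBlocks₁₁, Matrix.of_apply, hmul, hinl, Module.Basis.repr_self]
    simp
  · intro i j hi
    simp only [toBlocks₂₁, Matrix.of_apply, hmul, hinl, Module.Basis.repr_self]
    rw [Finsupp.single_apply, if_neg]
    intro h
    have := congrArg Fin.val (Sum.inr.inj h)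
    simp only at this
    omega
  · intro i j hj
    simp only [toBlocks₂₂, Matrix.of_apply, hmul]
    have key : ∃ w : Fin k → F, AdjoinRoot.root g * v (Sum.inr j) =
        b (Sum.inr ⟨j.1 + 1, hj⟩) + ∑ l, w l • b (Sum.inl l) := by
      by_cases h1 : j.1 + 1 < k
      · refine ⟨fun l => if l = ⟨j.1 + 1, h1⟩ then -1 else 0, ?_⟩
        simp only [ite_smul, zero_smul, Finset.sum_ite_eq', Finset.mem_univ, if_true, hb, v,
          Sum.elim_inl, Sum.elim_inr, hroot, neg_smul, one_smul]
        rw [← sub_eq_add_neg, ← map_sub]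
        congr 1
        simp only [s, if_pos h1, if_pos (show j.1 < k by omega), κ]
        have : k - 1 - j.1 = (k - 1 - (j.1 + 1)) + 1 := by omega
        rw [this]; ring
      · refine ⟨0, ?_⟩
        simp only [Pi.zero_apply, zero_smul, Finset.sum_const_zero, add_zero, hb, v,
          Sum.elim_inr, hroot]
        congr 1
        simp only [s, if_neg h1, κ]
        split_ifs with h2
        · have : k = j.1 + 1 := by omega
          have h3 : k - 1 - j.1 = 0 := by omega
          have h4 : k + (j.1 + 1) = 2 * j.1 + 2 := by omega
          rw [h3, h4]; ring
        · ring
    obtain ⟨w, hw⟩ := key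
    rw [hw, map_add, map_sum]
    simp only [map_smul, Module.Basis.repr_self, Finsupp.add_apply, Finsupp.finsetSum_apply,
      Finsupp.smul_apply, Finsupp.single_apply]
    simp [Fin.ext_iff, eq_comm]
  · rw [← Algebra.trace_eq_matrix_trace]
    have : Nontrivial (AdjoinRoot g) :=
      Module.nontrivial_of_finrank_pos (R := F) (by rw [hfr]; omega)
    have h := PowerBasis.trace_gen_eq_nextCoeff_minpoly (AdjoinRoot.powerBasis hg.ne_zero)
    rw [AdjoinRoot.minpoly_powerBasis_gen_of_monic hg, AdjoinRoot.powerBasis_gen] at h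
    rw [h, nextCoeff_of_natDegree_pos (by omega), hgn]
    simp only [g, coeff_sub, coeff_X_pow, coeff_X]
    rw [if_neg (by omega), if_neg (by omega)]; simp

theorem potent_plus_squareZero
    (F : Type*) [Field F] (n k : ℕ) (hn : 3 ≤ n) (hk : k < n - k)
    (A₂₂ : Matrix (Fin (n - k)) (Fin (n - k)) F)
    (hInv : IsUnit A₂₂)
    (hNonDerog : minpoly F A₂₂ = A₂₂.charpoly)
    (A : Matrix (Fin k ⊕ Fin (n - k)) (Fin k ⊕ Fin (n - k)) F)
    (hA : A = Matrix.fromBlocks 0 0 0 A₂₂)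
    (htr : A.trace = 0) :
    ∃ P N₁ : Matrix (Fin k ⊕ Fin (n - k)) (Fin k ⊕ Fin (n - k)) F,
      P ^ n = P ∧ N₁ ^ 2 = 0 ∧ A = P + N₁ := by
  obtain ⟨U, V, C, h1, h2, h3⟩ := aux_cyclic _ A₂₂ hNonDerog
  have hnk : n - k + k = n := by omega
  obtain ⟨P, p0, p1, p2, p3, p4⟩ := aux_P (F := F) k (n - k) hk (by omega)
  rw [hnk] at p0
  have ht : A₂₂.trace = 0 := by
    rw [hA, Matrix.trace, Fintype.sum_sum_type] at htr
    simpa [Matrix.trace] using htr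
  rw [hA]
  exact aux_final k (n - k) A₂₂ C U V h1 h2 hInv h3 ht n P p0 p1 p2 p3 p4
end
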